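/- Let G and G' be virtually free groups admitting decompositions as finite graphs of groups with trivial edge groups and finite vertex groups (i.e., G and G' are free products of finitely many finite groups and a finitely generated free group). Define k(G) = Σ_{edges e} 1/|G_e| − Σ_{vertices v} 1/|G_v| (which is independent of the decomposition). If φ : G ↠ G' is a surjective homomorphism that is injective on finite subgroups of G, then k(G) ≥ k(G'), with equality if and only if φ is an isomorphism. -/

import Mathlib

open scoped Classical

/-- The contribution of a free factor to the complexity of a Stallings decomposition with
trivial edge groups: `-1/|F|` for a finite factor `F`, and `0` for an infinite cyclic
factor (a loop over the trivial group contributes `1 - 1 = 0`). -/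
noncomputable def kFactor (X : Type*) : ℚ :=
  if Finite X then -((Nat.card X : ℚ))⁻¹ else 0

/-- The complexity `k(G) = Σ_e 1/|G_e| - Σ_v 1/|G_v|` of the free product of the family
`H` of factors (each finite or infinite cyclic), computed from the associated graph of
groups with trivial edge groups. -/
noncomputable def kComplexity {n : ℕ} (H : Fin n → Type*) : ℚ :=
  (∑ i, kFactor (H i)) + (n : ℚ) - 1

open Monoid

namespace Monoid.CoprodI

variable {ι : Type*} {G : ι → Type*} [∀ i, Group (G i)]

theorem NeWord.prod_ne_one {i j : ι} (w : NeWord G i j) : w.prod ≠ 1 := by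
  intro h
  have : w.toWord = Word.empty := Word.equiv.symm.injective (h.trans Word.prod_empty.symm)
  exact w.toList_ne_nil (congrArg Word.toList this)

theorem NeWord.not_isOfFinOrder_prod {i j : ι} (w : NeWord G i j) (hij : i ≠ j) :
    ¬ IsOfFinOrder w.prod := by
  have hpow (n : ℕ) : ∃ v : NeWord G i j, v.prod = w.prod ^ (n + 1) := by
    induction n with
    | zero => exact ⟨w, by simp⟩
    | succ n ih =>
      obtain ⟨v, hv⟩ := ih
      exact ⟨.append v hij.symm w, by rw [NeWord.append_prod, hv, pow_succ _ (n + 1)]⟩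
  rw [isOfFinOrder_iff_pow_eq_one]
  rintro ⟨n, hn, h⟩
  obtain ⟨v, hv⟩ := hpow (n - 1)
  rw [Nat.sub_add_cancel hn, h] at hv
  exact v.prod_ne_one hv

theorem Word.length_rcons_le {i : ι} (p : Word.Pair G i) :
    (Word.rcons p).toList.length ≤ p.tail.toList.length + 1 := by
  unfold Word.rcons
  split_ifs <;> simp

theorem Word.equivPair_smul_tail {i : ι} (m : G i) (w : Word G) :
    (Word.equivPair i (m • w)).tail = (Word.equivPair i w).tail := by
  rw [Word.smul_eq_of_smul, Word.equivPair_smul_same]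

theorem Word.length_smul_le {i : ι} (m : G i) (w : Word G) :
    (m • w).toList.length ≤ (Word.equivPair i w).tail.toList.length + 1 :=
  Word.length_rcons_le _

theorem Word.equivPair_cons_tail {i : ι} (m : G i) (w : Word G) (hw : w.fstIdx ≠ some i)
    (hm : m ≠ 1) : (Word.equivPair i (Word.cons m w hw hm)).tail = w := by
  rw [Word.cons_eq_smul, Word.equivPair_smul_same, Word.equivPair_eq_of_fstIdx_ne hw]

/-- Elements of finite order in a free product of groups are conjugate into a factor. -/
theorem exists_conj_eq_of {g : CoprodI G} (hg : IsOfFinOrder g) (hg1 : g ≠ 1) :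
    ∃ (c : CoprodI G) (i : ι) (m : G i), c * g * c⁻¹ = of m := by
  suffices H : ∀ (n : ℕ) (w : Word G), w.toList.length = n → IsOfFinOrder w.prod → w.prod ≠ 1 →
      ∃ (c : CoprodI G) (i : ι) (m : G i), c * w.prod * c⁻¹ = of m by
    obtain ⟨w, rfl⟩ := Word.equiv.symm.surjective g
    exact H _ w rfl hg hg1
  intro n
  induction n using Nat.strong_induction_on with
  | _ n ih =>
  intro w hn hfin hne
  have hw : w ≠ Word.empty := by rintro rfl; exact hne Word.prod_empty
  obtain ⟨i, j, v, rfl⟩ := NeWord.of_word w hw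
  obtain rfl | hij := eq_or_ne i j
  swap
  · exact absurd hfin (v.not_isOfFinOrder_prod hij)
  generalize hW : v.toWord = W at *
  have hlast : W.toList.getLast? = some ⟨i, v.last⟩ := by rw [← hW]; exact v.toList_getLast?
  have hhead : W.fstIdx = some i := by
    rw [← hW, Word.fstIdx]
    change v.toList.head?.map _ = _
    simp
  clear hW
  generalize v.last = b at *
  clear v
  have hsplit : W.toList.dropLast ++ [⟨i, b⟩] = W.toList :=
    List.dropLast_append_getLast? _ hlast
  let u : Word G := ⟨W.toList.dropLast, fun l hl => W.ne_one l (List.mem_of_mem_dropLast hl),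
    W.chain_ne.dropLast⟩
  have hprod : W.prod = u.prod * of b := by
    unfold Word.prod
    rw [← hsplit]
    simp [u]
  by_cases hu : u = Word.empty
  · exact ⟨1, i, b, by simp [hprod, hu]⟩
  have huW : u.toList.length + 1 = W.toList.length := by
    rw [← hsplit]; simp [u]
  have htail : (Word.equivPair i u).tail.toList.length < u.toList.length := by
    induction hu' : u using Word.consRecOn with
    | empty => exact absurd hu' hu
    | cons k m u' h1 h2 _ =>
      have : W.fstIdx = some k := by
        rw [Word.fstIdx, ← hsplit]
        change ((u.toList ++ _).head?).map _ = _
        rw [hu']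
        simp
      obtain rfl : i = k := by rw [hhead] at this; simpa using this
      rw [Word.equivPair_cons_tail]
      simp
  have hconj : (b • u).prod = of b * W.prod * (of b)⁻¹ := by
    rw [Word.smul_eq_of_smul, Word.prod_smul, hprod]; group
  have hlt : (b • u).toList.length < n := by
    have := Word.length_smul_le b u
    omega
  obtain ⟨c, k, m, h⟩ := ih _ hlt (b • u) rfl
    (by rw [hconj]; exact (MulAut.conj (of b)).toMonoidHom.isOfFinOrder hfin)
    (by rw [hconj]; simpa using hne)
  exact ⟨c * of b, k, m, by rw [← h, hconj]; group⟩

/-- The truncation to words of length at most `L` of the action of a factor on reduced words. -/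
noncomputable abbrev truncatedAction (G : ι → Type*) [∀ i, Group (G i)] (L : ℕ) (i : ι) :
    MulAction (G i) {w : Word G // w.toList.length ≤ L} where
  smul m w := ⟨if (Word.equivPair i w.1).tail.toList.length < L then m • w.1 else w.1, by
    split_ifs with h
    · exact (Word.length_smul_le m w.1).trans h
    · exact w.2⟩
  one_smul w := by
    apply Subtype.ext
    change ite _ _ _ = _
    simp
  mul_smul a b w := by
    apply Subtype.ext
    change ite _ _ _ = if (Word.equivPair i (ite _ _ _)).tail.toList.length < L then
      a • (ite _ _ _) else ite _ _ _
    by_cases h : (Word.equivPair i w.1).tail.toList.length < L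
    · simp [h, Word.equivPair_smul_tail, mul_smul]
    · simp [h]

/-- The action of the free product by permutations of the reduced words of length at most `L`. -/
noncomputable def truncatedPermHom (G : ι → Type*) [∀ i, Group (G i)] (L : ℕ) :
    CoprodI G →* Equiv.Perm {w : Word G // w.toList.length ≤ L} :=
  lift fun i => @MulAction.toPermHom _ _ _ (truncatedAction G L i)

theorem truncatedPermHom_of_apply (L : ℕ) {i : ι} (m : G i)
    (w : {w : Word G // w.toList.length ≤ L}) :
    (truncatedPermHom G L (of m) w).1 =
      if (Word.equivPair i w.1).tail.toList.length < L then m • w.1 else w.1 := by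
  rw [truncatedPermHom, lift_of]
  rfl

theorem truncatedPermHom_prod_apply_empty (L : ℕ) (w : Word G) (hw : w.toList.length ≤ L) :
    truncatedPermHom G L w.prod ⟨Word.empty, Nat.zero_le L⟩ = ⟨w, hw⟩ := by
  induction w using Word.consRecOn with
  | empty => simp
  | cons i m w h1 h2 ih =>
    have hw' : w.toList.length < L := hw
    apply Subtype.ext
    rw [Word.prod_cons, map_mul, Equiv.Perm.mul_apply, ih hw'.le, truncatedPermHom_of_apply,
      Word.equivPair_eq_of_fstIdx_ne h1, if_pos hw']
    exact (Word.cons_eq_smul (h1 := h1) (h2 := h2)).symm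

theorem finite_word_length_le [Finite ι] [∀ i, Finite (G i)] (L : ℕ) :
    Finite {w : Word G // w.toList.length ≤ L} := by
  have : Finite {l : List (Σ i, G i) // l.length ≤ L} := List.finite_length_le _ L
  exact Finite.of_injective
    (fun w => (⟨w.1.toList, w.2⟩ : {l : List (Σ i, G i) // l.length ≤ L}))
    fun v w h => Subtype.ext (Word.ext (congrArg Subtype.val h))

end Monoid.CoprodI

/-- Every nontrivial element survives in a finite quotient. -/
def SeparatedByFinite (G : Type*) [Group G] : Prop :=
  ∀ g : G, g ≠ 1 → ∃ (Q : Type) (_ : Group Q) (_ : Finite Q) (f : G →* Q), f g ≠ 1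

namespace SeparatedByFinite

theorem of_finite (G : Type) [Group G] [Finite G] : SeparatedByFinite G :=
  fun _ hg => ⟨G, inferInstance, inferInstance, MonoidHom.id G, hg⟩

theorem of_mulEquiv_int {G : Type*} [Group G] (e : G ≃* Multiplicative ℤ) :
    SeparatedByFinite G := by
  intro g hg
  let z : ℤ := (e g).toAdd
  have hz : z ≠ 0 := by simpa [z] using hg
  refine ⟨Multiplicative (ZMod (z.natAbs + 1)), inferInstance, inferInstance,
    (AddMonoidHom.toMultiplicative (Int.castAddHom (ZMod (z.natAbs + 1)))).comp e.toMonoidHom, ?_⟩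
  change ((z : ZMod (z.natAbs + 1))) ≠ 0
  rw [Ne, ZMod.intCast_zmod_eq_zero_iff_dvd]
  intro h
  exact absurd (Nat.le_of_dvd (Int.natAbs_pos.2 hz) (Int.natCast_dvd.1 h))
    (Nat.not_succ_le_self _)

theorem finset {G : Type*} [Group G] (hG : SeparatedByFinite G) (S : Finset G) (hS : 1 ∉ S) :
    ∃ (Q : Type) (_ : Group Q) (_ : Finite Q) (f : G →* Q), ∀ g ∈ S, f g ≠ 1 := by
  induction S using Finset.induction_on with
  | empty => exact ⟨PUnit, inferInstance, inferInstance, 1, by simp⟩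
  | insert a S _ ih =>
    obtain ⟨Q, _, _, f, hf⟩ := ih fun h => hS (Finset.mem_insert_of_mem h)
    obtain ⟨R, _, _, f', hf'⟩ := hG a fun h => hS (h ▸ Finset.mem_insert_self a S)
    refine ⟨Q × R, inferInstance, inferInstance, f.prod f', fun g hg h => ?_⟩
    obtain rfl | hg := Finset.mem_insert.1 hg
    · exact hf' (congrArg Prod.snd h)
    · exact hf g hg (congrArg Prod.fst h)

open Monoid CoprodI

/-- A free product of finitely many residually finite groups is residually finite. -/
theorem coprodI {ι : Type} [Finite ι] {G : ι → Type*} [∀ i, Group (G i)]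
    (hG : ∀ i, SeparatedByFinite (G i)) : SeparatedByFinite (CoprodI G) := by
  intro g hg
  obtain ⟨w, rfl⟩ := Word.equiv.symm.surjective g
  change w.prod ≠ 1 at hg
  have hS (i : ι) : (1 : G i) ∉ w.toList.toFinset.preimage (Sigma.mk i)
      sigma_mk_injective.injOn := by
    simp only [Finset.mem_preimage, List.mem_toFinset]
    exact fun h => w.ne_one _ h rfl
  choose K instG instF f hf using fun i => (hG i).finset _ (hS i)
  replace hf : ∀ l ∈ w.toList, f l.1 l.2 ≠ 1 := fun l hl =>
    hf l.1 l.2 (by simpa using hl)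
  have key : ∃ v : Word K, v.fstIdx = w.fstIdx ∧ v.toList.length = w.toList.length ∧
      v.prod = lift (fun i => of.comp (f i)) w.prod := by
    clear hg hS
    induction w using Word.consRecOn with
    | empty => exact ⟨Word.empty, rfl, rfl, by simp⟩
    | cons i m w h1 h2 ih =>
      obtain ⟨v, hv1, hv2, hv3⟩ := ih fun l hl => hf l (List.mem_cons_of_mem _ hl)
      refine ⟨Word.cons (f i m) v (hv1 ▸ h1) (hf ⟨i, m⟩ List.mem_cons_self), ?_, ?_, ?_⟩
      · simp
      · simp [hv2]
      · simp [hv3]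
  obtain ⟨v, -, hvw, hv⟩ := key
  have := finite_word_length_le (G := K) v.toList.length
  refine ⟨Equiv.Perm {u : Word K // u.toList.length ≤ v.toList.length}, inferInstance,
    inferInstance, (truncatedPermHom K _).comp (lift fun i => of.comp (f i)), fun h => hg ?_⟩
  have h' := truncatedPermHom_prod_apply_empty v.toList.length v le_rfl
  rw [hv, ← MonoidHom.comp_apply] at h'
  rw [show (truncatedPermHom K _).comp (lift fun i => of.comp (f i)) w.prod = 1 from h] at h'
  have hv0 : v = Word.empty := (congrArg Subtype.val h').symm
  have hw0 : w = Word.empty := by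
    apply Word.ext
    rw [hv0] at hvw
    exact List.eq_nil_of_length_eq_zero hvw.symm
  rw [hw0, Word.prod_empty]

end SeparatedByFinite

namespace RegularWreathProduct

/-- The lifts of a homomorphism `α : G →* Γ` to the regular wreath product `Q ≀ᵣ Γ`. -/
abbrev Lifts (Q : Type*) [Group Q] {G Γ : Type*} [Group G] [Group Γ] (α : G →* Γ) : Type _ :=
  {f : G →* Q ≀ᵣ Γ // rightHom.comp f = α}

variable {Q : Type*} [Group Q] {G Γ : Type*} [Group G] [Group Γ]

theorem Lifts.right_apply {α : G →* Γ} (f : Lifts Q α) (g : G) : (f.1 g).right = α g :=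
  DFunLike.congr_fun f.2 g

theorem Lifts.left_mul {α : G →* Γ} (f : Lifts Q α) (g h : G) (x : Γ) :
    (f.1 (g * h)).left x = (f.1 g).left x * (f.1 h).left ((α g)⁻¹ * x) := by
  rw [map_mul, mul_left, f.right_apply]
  rfl

theorem Lifts.ext {α : G →* Γ} {f f' : Lifts Q α}
    (h : ∀ g x, (f.1 g).left x = (f'.1 g).left x) : f = f' :=
  Subtype.ext <| MonoidHom.ext fun g => RegularWreathProduct.ext (funext (h g))
    ((f.right_apply g).trans (f'.right_apply g).symm)

/-- The coboundary of a function `F : Γ → Q`, as a lift of `α`. -/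
def Lifts.coboundary (α : G →* Γ) (F : Γ → Q) : Lifts Q α :=
  ⟨{ toFun := fun g => ⟨fun x => F x * (F ((α g)⁻¹ * x))⁻¹, α g⟩
     map_one' := by ext <;> simp
     map_mul' := fun g h => by ext <;> simp [mul_assoc] }, rfl⟩

theorem card_lifts_of_mulEquiv_int (e : G ≃* Multiplicative ℤ) [Finite Γ] (α : G →* Γ) :
    Nat.card (Lifts Q α) = Nat.card Q ^ Nat.card Γ := by
  rw [← Nat.card_fun]
  refine Nat.card_congr (Equiv.ofBijective
    (fun f : Lifts Q α => (f.1 (e.symm (.ofAdd 1))).left) ⟨fun f f' h => ?_, fun c => ?_⟩)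
  · apply Subtype.ext
    have hext : f.1.comp e.symm.toMonoidHom = f'.1.comp e.symm.toMonoidHom :=
      MonoidHom.ext_mint (RegularWreathProduct.ext h
        ((f.right_apply _).trans (f'.right_apply _).symm))
    ext1 g
    simpa using DFunLike.congr_fun hext (e g)
  · let p : Q ≀ᵣ Γ := ⟨c, α (e.symm (.ofAdd 1))⟩
    refine ⟨⟨(zpowersHom _ p).comp e.toMonoidHom, ?_⟩, ?_⟩
    · have hext : (rightHom.comp ((zpowersHom _ p).comp e.toMonoidHom)).comp
          e.symm.toMonoidHom = α.comp e.symm.toMonoidHom :=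
        MonoidHom.ext_mint (by simp [p])
      ext1 g
      simpa using DFunLike.congr_fun hext (e g)
    · simp [p]

theorem card_lifts_mul_of_injective [Finite Γ] (α : G →* Γ)
    (hα : Function.Injective α) :
    Nat.card (Lifts Q α) * Nat.card Q ^ (Nat.card Γ / Nat.card G) =
      Nat.card Q ^ Nat.card Γ := by
  obtain ⟨T, hT, -⟩ := α.range.exists_isComplement_right 1
  have hcard : Nat.card Γ / Nat.card G = Nat.card T := by
    have hG : Finite G := Finite.of_injective α hα
    rw [← hT.card_mul_card, Nat.card_congr (MonoidHom.ofInjective hα).toEquiv]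
    exact (Nat.mul_div_cancel_left _ Nat.card_pos)
  rw [hcard, ← Nat.card_fun, ← Nat.card_fun, ← Nat.card_prod]
  have hdec (x : Γ) : ∃ (g : G) (t : T), x = α g * t := by
    obtain ⟨⟨⟨_, g, rfl⟩, t⟩, h⟩ := hT.surjective x
    exact ⟨g, t, h.symm⟩
  have huniq {g g' : G} {t t' : T} (h : α g * t = α g' * t') : g = g' ∧ t = t' := by
    have := hT.injective (a₁ := (⟨α g, g, rfl⟩, t)) (a₂ := (⟨α g', g', rfl⟩, t')) h
    rw [Prod.mk.injEq] at this
    exact ⟨hα (congrArg Subtype.val this.1), this.2⟩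
  choose a t hat using hdec
  have ha (g : G) (s : T) : a (α g * s) = g := (huniq (hat (α g * s))).1.symm
  have ht (g : G) (s : T) : t (α g * s) = s := (huniq (hat (α g * s))).2.symm
  refine Nat.card_congr (Equiv.ofBijective
    (fun p : Lifts Q α × (T → Q) => fun x => (p.1.1 (a x)).left x * p.2 (t x)) ⟨?_, ?_⟩)
  · rintro ⟨f, u⟩ ⟨f', u'⟩ h
    have hval (g : G) (s : T) : (f.1 g).left (α g * s) * u s = (f'.1 g).left (α g * s) * u' s := by
      simpa [ha, ht] using congrFun h (α g * s)
    have hu : u = u' := funext fun s => by simpa using hval 1 s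
    subst hu
    have hval' (g : G) (s : T) : (f.1 g).left (α g * s) = (f'.1 g).left (α g * s) :=
      mul_right_cancel (hval g s)
    refine Prod.ext (Lifts.ext fun k x => ?_) rfl
    obtain ⟨h, s, rfl⟩ : ∃ (h : G) (s : T), x = α k * (α h * s) :=
      ⟨k⁻¹ * a x, t x, by rw [map_mul, map_inv, mul_assoc, mul_inv_cancel_left]; exact hat x⟩
    have h1 := f.left_mul k h (α k * (α h * s))
    have h2 := f'.left_mul k h (α k * (α h * s))
    rw [inv_mul_cancel_left] at h1 h2
    rw [hval' h s, ← mul_assoc, ← map_mul, hval', map_mul α, mul_assoc, h2] at h1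
    exact (mul_right_cancel h1).symm
  · intro F
    refine ⟨(Lifts.coboundary α F, fun s => F s), funext fun x => ?_⟩
    change F x * (F ((α (a x))⁻¹ * x))⁻¹ * F (t x) = F x
    nth_rewrite 3 [hat x]
    simp

/-- Lifts from a free product are families of lifts from the factors. -/
def liftsCoprodIEquiv {ι : Type*} {G : ι → Type*} [∀ i, Group (G i)]
    (α : Monoid.CoprodI G →* Γ) :
    Lifts Q α ≃ ∀ i, Lifts Q (α.comp (Monoid.CoprodI.of (i := i))) where
  toFun f i := ⟨f.1.comp Monoid.CoprodI.of, by rw [← MonoidHom.comp_assoc, f.2]⟩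
  invFun f := ⟨Monoid.CoprodI.lift fun i => (f i).1, by
    ext1 i
    rw [MonoidHom.comp_assoc, Monoid.CoprodI.lift_comp_of, (f i).2]⟩
  left_inv f := Subtype.ext <| by
    ext1 i
    exact Monoid.CoprodI.lift_comp_of _ _
  right_inv f := funext fun i => Subtype.ext (Monoid.CoprodI.lift_comp_of _ _)

end RegularWreathProduct

section Complexity

open Monoid RegularWreathProduct

/-- The number of lifts to `Q ≀ᵣ Γ` of a homomorphism from a free product to `Γ` that is injective
on the finite factors is a power of `|Q|` whose exponent is determined by the complexity. -/
theorem card_lifts_eq_pow_kComplexity {n : ℕ} (H : Fin n → Type) [∀ i, Group (H i)]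
    (hH : ∀ i, Finite (H i) ∨ Nonempty (H i ≃* Multiplicative ℤ))
    {Γ : Type} [Group Γ] [Finite Γ] (α : CoprodI H →* Γ)
    (hα : ∀ i, Finite (H i) → Function.Injective (α.comp (CoprodI.of (i := i)))) :
    ∃ s : ℕ, (s : ℚ) = Nat.card Γ * (kComplexity H + 1) ∧
      ∀ (Q : Type) [Group Q] [Finite Q], Nat.card (Lifts Q α) = Nat.card Q ^ s := by
  have key (i : Fin n) : ∃ s : ℕ, (s : ℚ) = Nat.card Γ * (kFactor (H i) + 1) ∧
      ∀ (Q : Type) [Group Q] [Finite Q],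
        Nat.card (Lifts Q (α.comp (CoprodI.of (i := i)))) = Nat.card Q ^ s := by
    by_cases hi : Finite (H i)
    · have hle : Nat.card Γ / Nat.card (H i) ≤ Nat.card Γ := Nat.div_le_self _ _
      refine ⟨Nat.card Γ - Nat.card Γ / Nat.card (H i), ?_, fun Q _ _ => ?_⟩
      · have hpos : (Nat.card (H i) : ℚ) ≠ 0 := by exact_mod_cast Nat.card_pos.ne'
        rw [Nat.cast_sub hle,
          Nat.cast_div (Subgroup.card_dvd_of_injective _ (hα i hi)) hpos, kFactor, if_pos hi]
        ring
      · apply mul_right_cancel₀ (pow_ne_zero (Nat.card Γ / Nat.card (H i))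
          (Nat.card_pos (α := Q)).ne')
        rw [card_lifts_mul_of_injective _ (hα i hi), ← pow_add, Nat.sub_add_cancel hle]
    · obtain ⟨e⟩ := (hH i).resolve_left hi
      exact ⟨Nat.card Γ, by simp [kFactor, hi], fun Q _ _ => card_lifts_of_mulEquiv_int e _⟩
  choose s hs hcard using key
  refine ⟨∑ i, s i, ?_, fun Q _ _ => ?_⟩
  · rw [Nat.cast_sum, Finset.sum_congr rfl fun i _ => hs i, ← Finset.mul_sum,
      Finset.sum_add_distrib, kComplexity]
    simp
  · rw [Nat.card_congr (liftsCoprodIEquiv α), Nat.card_pi, Finset.prod_congr rfl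
      fun i _ => hcard i Q, Finset.prod_pow_eq_pow_sum]

/-- A free product of finitely many finite and infinite cyclic groups has a homomorphism to a
finite group with torsion-free kernel. -/
theorem exists_finite_hom_torsionFree_ker {n : ℕ} (H : Fin n → Type) [∀ i, Group (H i)]
    (hH : ∀ i, Finite (H i) ∨ Nonempty (H i ≃* Multiplicative ℤ)) :
    ∃ (Γ : Type) (_ : Group Γ) (_ : Finite Γ) (π : CoprodI H →* Γ),
      ∀ g, IsOfFinOrder g → π g = 1 → g = 1 := by
  have hfac (i : Fin n) : ∃ (K : Type) (_ : Group K) (_ : Finite K) (f : H i →* K),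
      ∀ m, IsOfFinOrder m → f m = 1 → m = 1 := by
    by_cases hi : Finite (H i)
    · exact ⟨H i, inferInstance, hi, MonoidHom.id _, fun _ _ h => h⟩
    · obtain ⟨e⟩ := (hH i).resolve_left hi
      refine ⟨PUnit, inferInstance, inferInstance, 1, fun m hm _ => ?_⟩
      have h := e.toMonoidHom.isOfFinOrder hm
      have h1 : e m = 1 := by
        obtain ⟨k, hk, hk'⟩ := isOfFinOrder_iff_pow_eq_one.1 h
        have : k * (e m).toAdd = 0 := by simpa using congrArg Multiplicative.toAdd hk'
        have : (e m).toAdd = 0 := by simpa [hk.ne'] using this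
        exact this
      simpa using h1
  choose K _ _ f hf using hfac
  refine ⟨∀ i, K i, inferInstance, inferInstance,
    CoprodI.lift fun i => (MonoidHom.mulSingle K i).comp (f i), fun g hg h => ?_⟩
  by_contra hg1
  obtain ⟨c, i, m, hm⟩ := CoprodI.exists_conj_eq_of hg hg1
  have hfin : IsOfFinOrder m := by
    rw [← (CoprodI.of_injective i).isOfFinOrder_iff, ← hm]
    exact (MulAut.conj c).toMonoidHom.isOfFinOrder hg
  have hm1 : f i m = 1 := by
    have := congrArg (CoprodI.lift fun i => (MonoidHom.mulSingle K i).comp (f i)) hm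
    rw [map_mul, map_mul, h, mul_one, map_inv, mul_inv_cancel, CoprodI.lift_of] at this
    exact Pi.mulSingle_injective i (this.symm.trans (Pi.mulSingle_one i).symm)
  rw [hf i m hfin hm1, map_one, conj_eq_one_iff] at hm
  exact hg1 hm

theorem SeparatedByFinite.coprodI_of_finite_or_int {n : ℕ} (H : Fin n → Type) [∀ i, Group (H i)]
    (hH : ∀ i, Finite (H i) ∨ Nonempty (H i ≃* Multiplicative ℤ)) :
    SeparatedByFinite (CoprodI H) :=
  .coprodI fun i => (hH i).elim (fun _ => .of_finite _) fun ⟨e⟩ => .of_mulEquiv_int e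

/-- Complexity does not increase under surjections injective on finite subgroups, and such a
surjection between groups of the same complexity is injective. -/
theorem kComplexity_le_and_injective_of_eq {n n' : ℕ} (H : Fin n → Type) (H' : Fin n' → Type)
    [∀ i, Group (H i)] [∀ i, Group (H' i)]
    (hH : ∀ i, Finite (H i) ∨ Nonempty (H i ≃* Multiplicative ℤ))
    (hH' : ∀ i, Finite (H' i) ∨ Nonempty (H' i ≃* Multiplicative ℤ))
    (φ : CoprodI H →* CoprodI H') (hsurj : Function.Surjective φ)
    (hinj : ∀ F : Subgroup (CoprodI H), (F : Set (CoprodI H)).Finite →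
      Set.InjOn φ (F : Set (CoprodI H))) :
    kComplexity H' ≤ kComplexity H ∧
      (kComplexity H = kComplexity H' → Function.Injective φ) := by
  obtain ⟨Γ, _, _, π, hπ⟩ := exists_finite_hom_torsionFree_ker H' hH'
  have hfac (i : Fin n) (_ : Finite (H i)) :
      Function.Injective ((π.comp φ).comp (CoprodI.of (i := i))) := by
    rw [injective_iff_map_eq_one]
    intro m hm
    have h1 : φ (CoprodI.of m) = 1 :=
      hπ _ ((φ.comp CoprodI.of).isOfFinOrder (isOfFinOrder_of_finite m)) hm
    have h2 := hinj (CoprodI.of (i := i)).range (Set.finite_range _) ⟨m, rfl⟩ (one_mem _)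
      (h1.trans (map_one φ).symm)
    exact CoprodI.of_injective i (h2.trans (map_one _).symm)
  have hfac' (i : Fin n') (_ : Finite (H' i)) :
      Function.Injective (π.comp (CoprodI.of (i := i))) := by
    rw [injective_iff_map_eq_one]
    intro m hm
    have := hπ _ ((CoprodI.of (i := i)).isOfFinOrder (isOfFinOrder_of_finite m)) hm
    exact CoprodI.of_injective i (this.trans (map_one _).symm)
  obtain ⟨s, hs, hcard⟩ := card_lifts_eq_pow_kComplexity H hH (π.comp φ) hfac
  obtain ⟨s', hs', hcard'⟩ := card_lifts_eq_pow_kComplexity H' hH' π hfac'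
  have hΓ : (0 : ℚ) < Nat.card Γ := by exact_mod_cast Nat.card_pos
  let pull (Q : Type) [Group Q] (f : Lifts Q π) : Lifts Q (π.comp φ) :=
    ⟨f.1.comp φ, by rw [← MonoidHom.comp_assoc, f.2]⟩
  have hpull (Q : Type) [Group Q] : Function.Injective (pull Q) := fun f f' h =>
    Subtype.ext ((MonoidHom.cancel_right hsurj).1 (congrArg Subtype.val h))
  have hfinite (Q : Type) [Group Q] [Finite Q] : Finite (Lifts Q (π.comp φ)) :=
    Nat.finite_of_card_ne_zero (by rw [hcard Q]; exact pow_ne_zero _ Nat.card_pos.ne')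
  refine ⟨?_, fun heq => ?_⟩
  · have h2 : Nat.card (Multiplicative (ZMod 2)) = 2 := by simp
    have hle := Nat.card_le_card_of_injective _ (hpull (Multiplicative (ZMod 2)))
    rw [hcard, hcard', h2, Nat.pow_le_pow_iff_right one_lt_two] at hle
    have : (s' : ℚ) ≤ s := by exact_mod_cast hle
    rw [hs, hs', mul_le_mul_iff_right₀ hΓ] at this
    linarith
  · have hss : s = s' := by
      have : (s : ℚ) = s' := by rw [hs, hs', heq]
      exact_mod_cast this
    rw [injective_iff_map_eq_one]
    intro g hg
    by_contra hg1
    obtain ⟨Q, _, _, ρ, hρ⟩ := SeparatedByFinite.coprodI_of_finite_or_int H hH g hg1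
    have hbij := (hpull Q).bijective_of_nat_card_le (by rw [hcard, hcard', hss])
    let f : Lifts Q (π.comp φ) :=
      ⟨{ toFun := fun x => ⟨fun _ => ρ x, π (φ x)⟩
         map_one' := by ext <;> simp
         map_mul' := fun x y => by ext <;> simp }, rfl⟩
    obtain ⟨f', hf'⟩ := hbij.2 f
    have h1 : f.1 g = 1 := by
      rw [← hf']
      change f'.1 (φ g) = 1
      rw [hg, map_one]
    exact hρ (congrFun (congrArg RegularWreathProduct.left h1) 1)

end Complexity

/-- If `G`, `G'` are free products of finitely many finite groups and a finitely generated
free group (i.e. admit decompositions with trivial edge groups and finite vertex groups),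
and `φ : G ↠ G'` is surjective and injective on finite subgroups, then `k(G) ≥ k(G')`,
with equality iff `φ` is an isomorphism. -/
theorem stmt_12 {n n' : ℕ} (H : Fin n → Type) (H' : Fin n' → Type)
    [∀ i, Group (H i)] [∀ i, Group (H' i)]
    (hH : ∀ i, Finite (H i) ∨ Nonempty (H i ≃* Multiplicative ℤ))
    (hH' : ∀ i, Finite (H' i) ∨ Nonempty (H' i ≃* Multiplicative ℤ))
    (φ : Monoid.CoprodI H →* Monoid.CoprodI H')
    (hsurj : Function.Surjective φ)
    (hinj : ∀ F : Subgroup (Monoid.CoprodI H),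
      (F : Set (Monoid.CoprodI H)).Finite → Set.InjOn φ (F : Set (Monoid.CoprodI H))) :
    kComplexity H' ≤ kComplexity H ∧
      (kComplexity H = kComplexity H' ↔ Function.Bijective φ) := by
  obtain ⟨hle, hinj_of_eq⟩ := kComplexity_le_and_injective_of_eq H H' hH hH' φ hsurj hinj
  refine ⟨hle, fun h => ⟨hinj_of_eq h, hsurj⟩, fun hbij => le_antisymm ?_ hle⟩
  let e := MulEquiv.ofBijective φ hbij
  exact (kComplexity_le_and_injective_of_eq H' H hH' hH e.symm.toMonoidHom e.symm.surjective
    fun _ _ => e.symm.injective.injOn).1
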